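/- arXiv:2502.01032 — 2 statements merged into one kernel-verified Lean document; each statement's English description precedes it below -/
import Mathlib

section
/- Let (X, Y) be jointly Gaussian: X = μ_X + a Z_1 + b Z_2 and Y = μ_Y + c Z_1, where Z_1, Z_2 are independent standard Gaussian variables and c ≠ 0. Let g : ℝ → ℝ be differentiable with g'(Y) integrable and g(Y)·X integrable. Then Cov(g(Y), X) = Cov(Y, X) · E[g'(Y)]; in particular, E[g(Y) X] = E[g(Y)]E[X] + Cov(Y, X)·E[g'(Y)]. -/
open MeasureTheory ProbabilityTheory Real

/-- A continuous function whose product with `α + a x`, `a ≠ 0`, is integrable against a finite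
measure is itself integrable. -/
theorem integrable_of_integrable_mul_affine {ν : Measure ℝ} [IsFiniteMeasure ν] {h : ℝ → ℝ}
    (hh : Continuous h) {α a : ℝ} (ha : a ≠ 0)
    (hi : Integrable (fun x => h x * (α + a * x)) ν) : Integrable h ν := by
  set r : ℝ := (1 + |α|) / |a| with hr
  obtain ⟨M, hM⟩ := (isCompact_Icc (a := -r) (b := r)).exists_bound_of_continuousOn hh.continuousOn
  refine (hi.norm.add (integrable_const |M|)).mono' hh.aestronglyMeasurable (ae_of_all _ fun x => ?_)
  simp only [Pi.add_apply, norm_mul]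
  by_cases hx : x ∈ Set.Icc (-r) r
  · nlinarith [hM x hx, le_abs_self M, mul_nonneg (norm_nonneg (h x)) (norm_nonneg (α + a * x))]
  · have hrx : r < |x| := by
      contrapose! hx
      exact abs_le.mp hx
    have hax : 1 + |α| < |a| * |x| := by
      rwa [hr, div_lt_iff₀' (abs_pos.mpr ha)] at hrx
    have h_one : 1 ≤ ‖α + a * x‖ := by
      have := abs_sub_abs_le_abs_sub (a * x) (-α)
      rw [abs_mul, abs_neg, sub_neg_eq_add, add_comm (a * x)] at this
      rw [norm_eq_abs]
      linarith
    nlinarith [norm_nonneg (h x), abs_nonneg M]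

theorem hasDerivAt_gaussianPDFReal_zero_one (x : ℝ) :
    HasDerivAt (gaussianPDFReal 0 1) (-x * gaussianPDFReal 0 1 x) x := by
  have h : HasDerivAt (fun y : ℝ => -(y - 0) ^ 2 / (2 * ((1 : NNReal) : ℝ))) (-x) x := by
    refine ((((hasDerivAt_id x).sub_const 0).pow 2).neg.div_const _).congr_deriv ?_
    simp
    ring
  rw [gaussianPDFReal_def]
  exact (h.exp.const_mul _).congr_deriv (by ring)

theorem integrable_gaussianReal_zero_one_iff {f : ℝ → ℝ} :
    Integrable f (gaussianReal 0 1) ↔ Integrable (fun x => gaussianPDFReal 0 1 x * f x) := by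
  rw [gaussianReal_of_var_ne_zero _ one_ne_zero,
    integrable_withDensity_iff_integrable_smul₀' (measurable_gaussianPDF 0 1).aemeasurable
      (ae_of_all _ fun _ => gaussianPDF_lt_top)]
  simp [toReal_gaussianPDF]

/-- **Stein's identity** for the standard Gaussian measure. -/
theorem integral_mul_id_gaussianReal {h : ℝ → ℝ} (hh : Differentiable ℝ h)
    (hi : Integrable h (gaussianReal 0 1))
    (hi_mul : Integrable (fun x => h x * x) (gaussianReal 0 1))
    (hi_deriv : Integrable (deriv h) (gaussianReal 0 1)) :
    ∫ x, h x * x ∂gaussianReal 0 1 = ∫ x, deriv h x ∂gaussianReal 0 1 := by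
  have hi_sub := hi_deriv.sub hi_mul
  have hd (x : ℝ) : HasDerivAt (fun y => gaussianPDFReal 0 1 y * h y)
      (gaussianPDFReal 0 1 x * (deriv h - fun y => h y * y) x) x := by
    refine ((hasDerivAt_gaussianPDFReal_zero_one x).mul (hh x).hasDerivAt).congr_deriv ?_
    simp only [Pi.sub_apply]
    ring
  have h_zero := integral_eq_zero_of_hasDerivAt_of_integrable hd
    (integrable_gaussianReal_zero_one_iff.mp hi_sub) (integrable_gaussianReal_zero_one_iff.mp hi)
  have h_eq : ∫ x, (deriv h - fun y => h y * y) x ∂gaussianReal 0 1 = 0 := by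
    simpa only [integral_gaussianReal_eq_integral_smul one_ne_zero, smul_eq_mul] using h_zero
  rw [integral_sub' hi_deriv hi_mul] at h_eq
  linarith

theorem integral_mul_affine_prod_gaussianReal {h : ℝ → ℝ} (hh : Differentiable ℝ h) (m a b : ℝ)
    (hi_deriv : Integrable (deriv h) (gaussianReal 0 1))
    (hi : Integrable (fun ω : ℝ × ℝ => h ω.1 * (m + a * ω.1 + b * ω.2))
      ((gaussianReal 0 1).prod (gaussianReal 0 1))) :
    ∫ ω : ℝ × ℝ, h ω.1 * (m + a * ω.1 + b * ω.2) ∂(gaussianReal 0 1).prod (gaussianReal 0 1) =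
      m * ∫ x, h x ∂gaussianReal 0 1 + a * ∫ x, deriv h x ∂gaussianReal 0 1 := by
  have hid : Integrable (fun x : ℝ => x) (gaussianReal 0 1) :=
    (memLp_id_gaussianReal 1).integrable le_rfl
  have h_inner (k : ℝ) : ∫ y, (k + b * y) ∂gaussianReal 0 1 = k := by
    rw [integral_add (integrable_const _) (hid.const_mul b), integral_const_mul,
      integral_id_gaussianReal]
    simp
  rw [integral_prod _ hi]
  simp only [integral_const_mul, h_inner]
  rcases eq_or_ne a 0 with rfl | ha
  · simp [mul_comm _ m, integral_const_mul]
  obtain ⟨y, hy⟩ := hi.prod_left_ae.exists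
  have hy' : Integrable (fun x => h x * ((m + b * y) + a * x)) (gaussianReal 0 1) := by
    simpa only [add_right_comm] using hy
  have hi_h := integrable_of_integrable_mul_affine hh.continuous ha hy'
  have hi_mul : Integrable (fun x => h x * x) (gaussianReal 0 1) := by
    refine ((hy'.sub (hi_h.mul_const (m + b * y))).const_mul a⁻¹).congr (ae_of_all _ fun x => ?_)
    simp only [Pi.sub_apply]
    field_simp
    ring
  rw [← integral_mul_id_gaussianReal hh hi_h hi_mul hi_deriv, ← integral_const_mul,
    ← integral_const_mul, ← integral_add (hi_h.const_mul m) (hi_mul.const_mul a)]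
  congr 1 with x
  ring

/-- **Stein's lemma for jointly Gaussian pairs.**  Let `(X, Y)` be jointly Gaussian:
`X = μX + a Z₁ + b Z₂`, `Y = μY + c Z₁` with `Z₁, Z₂` independent standard Gaussians
(the underlying space is `ℝ × ℝ ∋ (Z₁, Z₂)` with the product of two standard
Gaussian measures) and `c ≠ 0`.  If `g` is differentiable with `g'(Y)` integrable and
`g(Y)·X` integrable, then `Cov(g(Y), X) = Cov(Y, X) · E[g'(Y)]`; in particular,
`E[g(Y) X] = E[g(Y)] E[X] + Cov(Y, X) · E[g'(Y)]`.  Covariances are written out as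
`Cov(U,V) = E[UV] - E[U]E[V]`. -/
theorem stein_lemma_joint
    (μX μY a b c : ℝ) (hc : c ≠ 0)
    (P : Measure (ℝ × ℝ))
    (hP : P = (gaussianReal 0 1).prod (gaussianReal 0 1))
    (X Y : ℝ × ℝ → ℝ)
    (hX : X = fun ω => μX + a * ω.1 + b * ω.2)
    (hY : Y = fun ω => μY + c * ω.1)
    (g : ℝ → ℝ) (hg : Differentiable ℝ g)
    (h1 : Integrable (fun ω => deriv g (Y ω)) P)
    (h2 : Integrable (fun ω => g (Y ω) * X ω) P) :
    (∫ ω, g (Y ω) * X ω ∂P) - (∫ ω, g (Y ω) ∂P) * ∫ ω, X ω ∂P =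
      ((∫ ω, Y ω * X ω ∂P) - (∫ ω, Y ω ∂P) * ∫ ω, X ω ∂P) *
        ∫ ω, deriv g (Y ω) ∂P ∧
    ∫ ω, g (Y ω) * X ω ∂P =
      (∫ ω, g (Y ω) ∂P) * (∫ ω, X ω ∂P) +
        ((∫ ω, Y ω * X ω ∂P) - (∫ ω, Y ω ∂P) * ∫ ω, X ω ∂P) *
          ∫ ω, deriv g (Y ω) ∂P := by
  subst hP hX hY
  have h_fst (f : ℝ → ℝ) :
      ∫ ω : ℝ × ℝ, f ω.1 ∂(gaussianReal 0 1).prod (gaussianReal 0 1) =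
        ∫ x, f x ∂gaussianReal 0 1 := by
    simp [integral_fun_fst]
  have hid : MemLp (fun x : ℝ => x) 2 (gaussianReal 0 1) := memLp_id_gaussianReal 2
  have hi_X : MemLp (fun ω : ℝ × ℝ => μX + a * ω.1 + b * ω.2) 2
      ((gaussianReal 0 1).prod (gaussianReal 0 1)) :=
    ((memLp_const μX).add ((hid.comp_fst _).const_mul a)).add ((hid.comp_snd _).const_mul b)
  have hi_Y : MemLp (fun ω : ℝ × ℝ => μY + c * ω.1) 2
      ((gaussianReal 0 1).prod (gaussianReal 0 1)) :=
    (memLp_const μY).add ((hid.comp_fst _).const_mul c)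
  have hd_affine (x : ℝ) : HasDerivAt (fun y => μY + c * y) c x := by
    simpa using ((hasDerivAt_id x).const_mul c).const_add μY
  have hd_comp (x : ℝ) : HasDerivAt (fun y => g (μY + c * y)) (c * deriv g (μY + c * x)) x :=
    ((hg _).hasDerivAt.comp x (hd_affine x)).congr_deriv (mul_comm _ _)
  have h_deriv_affine : deriv (fun y => μY + c * y) = fun _ => c :=
    funext fun x => (hd_affine x).deriv
  have h_deriv_comp :
      deriv (fun y => g (μY + c * y)) = fun x => c * deriv g (μY + c * x) :=
    funext fun x => (hd_comp x).deriv
  have hi_deriv : Integrable (fun x => deriv g (μY + c * x)) (gaussianReal 0 1) :=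
    (Integrable.comp_fst_iff (IsProbabilityMeasure.ne_zero _)).mp h1
  have h_gYX := integral_mul_affine_prod_gaussianReal (fun x => (hd_comp x).differentiableAt)
    μX a b (h_deriv_comp ▸ hi_deriv.const_mul c) h2
  have h_YX := integral_mul_affine_prod_gaussianReal (fun x => (hd_affine x).differentiableAt)
    μX a b (h_deriv_affine ▸ integrable_const c) (hi_Y.integrable_mul hi_X)
  have h_X := integral_mul_affine_prod_gaussianReal (differentiable_const (1 : ℝ)) μX a b
    (by simp) (by simpa using hi_X.integrable one_le_two)
  simp only [h_deriv_comp, integral_const_mul] at h_gYX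
  simp only [h_deriv_affine, integral_const, probReal_univ, one_smul] at h_YX
  simp only [one_mul, deriv_const', integral_const, probReal_univ, smul_eq_mul, mul_one,
    mul_zero, add_zero] at h_X
  simp only [h_gYX, h_YX, h_X, h_fst fun x => g (μY + c * x), h_fst fun x => μY + c * x,
    h_fst fun x => deriv g (μY + c * x)]
  constructor <;> ring
end

section
/- For all real numbers a and b, ∫_{−∞}^∞ x · Φ(a + bx) · φ(x) dx = (b/√(1 + b²)) · φ(a/√(1 + b²)). -/
open MeasureTheory Real

/-- The standard normal density `φ(z) = exp(-z²/2)/√(2π)`. -/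
noncomputable def stdNormalPDF (z : ℝ) : ℝ := Real.exp (-(z ^ 2) / 2) / Real.sqrt (2 * Real.pi)

/-- The standard normal CDF `Φ(x) = ∫_{-∞}^x φ(z) dz`. -/
noncomputable def stdNormalCDF (x : ℝ) : ℝ := ∫ z in Set.Iic x, stdNormalPDF z

lemma stdNormalPDF_eq_gaussianPDFReal : stdNormalPDF = ProbabilityTheory.gaussianPDFReal 0 1 := by
  ext x
  simp [stdNormalPDF, ProbabilityTheory.gaussianPDFReal, div_eq_inv_mul]

lemma continuous_stdNormalPDF : Continuous stdNormalPDF := by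
  unfold stdNormalPDF
  fun_prop

lemma stdNormalPDF_nonneg (x : ℝ) : 0 ≤ stdNormalPDF x := by
  unfold stdNormalPDF
  positivity

lemma stdNormalPDF_le_inv_sqrt (x : ℝ) : stdNormalPDF x ≤ (√(2 * π))⁻¹ := by
  rw [stdNormalPDF, div_eq_inv_mul]
  refine mul_le_of_le_one_right (by positivity) (Real.exp_le_one_iff.2 ?_)
  linarith [sq_nonneg x]

lemma integrable_stdNormalPDF : Integrable stdNormalPDF := by
  rw [stdNormalPDF_eq_gaussianPDFReal]
  exact ProbabilityTheory.integrable_gaussianPDFReal 0 1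

lemma integral_stdNormalPDF : ∫ x, stdNormalPDF x = 1 := by
  rw [stdNormalPDF_eq_gaussianPDFReal]
  exact ProbabilityTheory.integral_gaussianPDFReal_eq_one 0 one_ne_zero

lemma integrable_mul_stdNormalPDF : Integrable fun x ↦ x * stdNormalPDF x := by
  convert (integrable_mul_exp_neg_mul_sq (b := 1 / 2) (by norm_num)).div_const (√(2 * π)) using 2
    with x
  rw [stdNormalPDF, mul_div_assoc]
  ring_nf

lemma hasDerivAt_stdNormalPDF (x : ℝ) : HasDerivAt stdNormalPDF (-(x * stdNormalPDF x)) x := by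
  refine ((((hasDerivAt_pow 2 x).neg.div_const 2).exp).div_const (√(2 * π))).congr_deriv ?_
  simp [stdNormalPDF]
  ring

lemma hasDerivAt_stdNormalCDF (x : ℝ) : HasDerivAt stdNormalCDF (stdNormalPDF x) x := by
  have h : stdNormalCDF = fun y ↦ stdNormalCDF 0 + ∫ z in (0 : ℝ)..y, stdNormalPDF z := by
    ext y
    rw [← intervalIntegral.integral_Iic_sub_Iic integrable_stdNormalPDF.integrableOn
      integrable_stdNormalPDF.integrableOn]
    simp [stdNormalCDF]
  rw [h]
  exact (continuous_stdNormalPDF.integral_hasStrictDerivAt 0 x).hasDerivAt.const_add _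

lemma norm_stdNormalCDF_le_one (x : ℝ) : ‖stdNormalCDF x‖ ≤ 1 := by
  rw [stdNormalCDF, Real.norm_of_nonneg (integral_nonneg stdNormalPDF_nonneg),
    ← integral_stdNormalPDF]
  exact setIntegral_le_integral integrable_stdNormalPDF (.of_forall stdNormalPDF_nonneg)

/-- Completing the square in a product of two normal densities. -/
lemma stdNormalPDF_affine_mul (a b x : ℝ) :
    stdNormalPDF (a + b * x) * stdNormalPDF x =
      stdNormalPDF (a / √(1 + b ^ 2)) *
        stdNormalPDF (√(1 + b ^ 2) * x + a * b / √(1 + b ^ 2)) := by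
  have hs : √(1 + b ^ 2) ^ 2 = 1 + b ^ 2 := Real.sq_sqrt (by positivity)
  have hpos : 0 < √(1 + b ^ 2) := by positivity
  simp only [stdNormalPDF, div_mul_div_comm, ← Real.exp_add]
  congr 2
  generalize √(1 + b ^ 2) = s at hs hpos
  have h : a ^ 2 = (1 + b ^ 2) * (a / s) ^ 2 := by
    rw [← hs]
    field_simp
  have h' : s * (a / s) = a := by field_simp
  rw [mul_div_right_comm]
  linear_combination -(1 / 2) * h + x ^ 2 / 2 * hs + b * x * h'

lemma integral_stdNormalPDF_affine_mul (a b : ℝ) :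
    ∫ x, stdNormalPDF (a + b * x) * stdNormalPDF x =
      stdNormalPDF (a / √(1 + b ^ 2)) / √(1 + b ^ 2) := by
  simp_rw [stdNormalPDF_affine_mul, integral_const_mul]
  rw [Measure.integral_comp_mul_left
      (fun y ↦ stdNormalPDF (y + a * b / √(1 + b ^ 2))),
    integral_add_right_eq_self stdNormalPDF, integral_stdNormalPDF,
    abs_of_nonneg (by positivity), smul_eq_mul, mul_one, div_eq_mul_inv (stdNormalPDF _)]

/-- For all reals `a, b`:
`∫_{-∞}^∞ x Φ(a + bx) φ(x) dx = (b/√(1+b²)) φ(a/√(1+b²))`. -/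
theorem integral_mul_normalCDF (a b : ℝ) :
    ∫ x : ℝ, x * stdNormalCDF (a + b * x) * stdNormalPDF x =
      b / Real.sqrt (1 + b ^ 2) * stdNormalPDF (a / Real.sqrt (1 + b ^ 2)) := by
  have hcdf (x : ℝ) : HasDerivAt (fun y ↦ stdNormalCDF (a + b * y))
      (stdNormalPDF (a + b * x) * b) x :=
    (hasDerivAt_stdNormalCDF _).comp x (by simpa using ((hasDerivAt_id x).const_mul b).const_add a)
  have hmeas : AEStronglyMeasurable fun x ↦ stdNormalCDF (a + b * x) :=
    (continuous_iff_continuousAt.2 fun x ↦ (hcdf x).continuousAt).aestronglyMeasurable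
  have hbdd : ∀ᵐ x : ℝ, ‖stdNormalCDF (a + b * x)‖ ≤ 1 :=
    .of_forall fun x ↦ norm_stdNormalCDF_le_one _
  have hpdf : Integrable fun x ↦ stdNormalPDF (a + b * x) * b * stdNormalPDF x := by
    refine integrable_stdNormalPDF.bdd_mul (c := (√(2 * π))⁻¹ * |b|)
      (((continuous_stdNormalPDF.comp (by fun_prop)).mul_const b).aestronglyMeasurable)
      (.of_forall fun x ↦ ?_)
    rw [norm_mul, Real.norm_of_nonneg (stdNormalPDF_nonneg _), Real.norm_eq_abs]
    gcongr
    exact stdNormalPDF_le_inv_sqrt _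
  have hparts := integral_mul_deriv_eq_deriv_mul_of_integrable
    (fun x _ ↦ hcdf x) (fun x _ ↦ hasDerivAt_stdNormalPDF x)
    (integrable_mul_stdNormalPDF.neg.bdd_mul hmeas hbdd) hpdf
    (integrable_stdNormalPDF.bdd_mul hmeas hbdd)
  simp_rw [mul_neg, integral_neg, neg_inj] at hparts
  calc ∫ x, x * stdNormalCDF (a + b * x) * stdNormalPDF x
      = ∫ x, stdNormalCDF (a + b * x) * (x * stdNormalPDF x) := by
        congr with x
        ring
    _ = ∫ x, b * (stdNormalPDF (a + b * x) * stdNormalPDF x) := by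
        rw [hparts]
        congr with x
        ring
    _ = b / √(1 + b ^ 2) * stdNormalPDF (a / √(1 + b ^ 2)) := by
        rw [integral_const_mul, integral_stdNormalPDF_affine_mul]
        ring
end
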